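/- For every complex number w with 0 < Re w < 1 and every integer L ≥ 0, the Hardy averaging operator M can be applied L times to φ_{w,0} (all the successive averaging integrals converge absolutely), and: for every compact subset Ω of the open strip {0 < Re w < 1} there is a constant C with |M^L(φ_{w,0})(t)| ≤ C·(1+log t)^L/t for all w ∈ Ω and t ≥ 1; and there is a constant C' such that |M^L(φ_{w,0})(t) − (1/(1−w))^L·U(w)·t^{−w}| ≤ C' for all w with 0 < Re w < 1 and all 0 < t ≤ 1. -/

import Mathlib

open MeasureTheory Set Filter intervalIntegral

/-- The Báez-Duarte spectral function
`U(w) = (w/(1-w))·2^{1-w}·π^{-w}·cos(πw/2)·Γ(w)`. -/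
noncomputable def baezDuarteU (w : ℂ) : ℂ :=
  (w / (1 - w)) * (2 : ℂ) ^ (1 - w) * (Real.pi : ℂ) ^ (-w)
    * Complex.cos ((Real.pi : ℂ) * w / 2) * Complex.Gamma w

/-- The Gamma integral `∫₀^∞ x^{w-1} e^{-rx} dx` for complex `r` in the right half-plane. -/
theorem integral_cpow_mul_cexp_neg_mul_Ioi {w : ℂ} (hw : 0 < w.re) {r : ℂ} (hr : 0 < r.re) :
    ∫ x in Ioi (0 : ℝ), (x : ℂ) ^ (w - 1) * Complex.exp (-(r * x))
      = r ^ (-w) * Complex.Gamma w := by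
  have hopen : IsOpen {r : ℂ | 0 < r.re} := isOpen_lt continuous_const Complex.continuous_re
  have hmeas : ∀ s r : ℂ, AEStronglyMeasurable
      (fun x : ℝ => (x : ℂ) ^ s * Complex.exp (-(r * x))) (volume.restrict (Ioi 0)) := by
    intro s r
    refine ContinuousOn.aestronglyMeasurable (fun x hx => ?_) measurableSet_Ioi
    exact ((Complex.continuousAt_ofReal_cpow_const _ _ (Or.inr (ne_of_gt hx))).mul
      (by fun_prop)).continuousWithinAt
  have hbound : ∀ (s : ℝ) (b : ℝ), -1 < s → 0 < b →
      IntegrableOn (fun x : ℝ => x ^ s * Real.exp (-b * x)) (Ioi 0) := by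
    intro s b hs hb
    simpa using integrableOn_rpow_mul_exp_neg_mul_rpow hs one_pos hb
  have hnorm : ∀ (s r : ℂ) (x : ℝ), 0 < x →
      ‖(x : ℂ) ^ s * Complex.exp (-(r * x))‖ = x ^ s.re * Real.exp (-r.re * x) := by
    intro s r x hx
    rw [norm_mul, Complex.norm_cpow_eq_rpow_re_of_pos hx, Complex.norm_exp]
    simp
  have hderiv : ∀ r₀ : ℂ, 0 < r₀.re → DifferentiableAt ℂ
      (fun r : ℂ => ∫ x in Ioi (0 : ℝ), (x : ℂ) ^ (w - 1) * Complex.exp (-(r * x))) r₀ := by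
    intro r₀ hr₀
    have h := hasDerivAt_integral_of_dominated_loc_of_deriv_le
      (μ := volume.restrict (Ioi (0 : ℝ)))
      (F := fun (r : ℂ) (x : ℝ) => (x : ℂ) ^ (w - 1) * Complex.exp (-(r * x)))
      (F' := fun (r : ℂ) (x : ℝ) => -((x : ℂ) ^ w * Complex.exp (-(r * x))))
      (s := {r : ℂ | r₀.re / 2 < r.re}) (x₀ := r₀)
      (bound := fun x : ℝ => x ^ w.re * Real.exp (-(r₀.re / 2) * x))
      ((isOpen_lt continuous_const Complex.continuous_re).mem_nhds (half_lt_self hr₀))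
      (Eventually.of_forall fun r => hmeas _ r) ?_ (hmeas _ _).neg ?_
      (hbound _ _ (by linarith) (by positivity)) ?_
    · exact h.2.differentiableAt
    · refine (hbound (w.re - 1) r₀.re (by linarith) hr₀).mono' (hmeas _ _) ?_
      filter_upwards [ae_restrict_mem measurableSet_Ioi] with x hx
      rw [hnorm _ _ _ hx]
      simp
    · filter_upwards [ae_restrict_mem measurableSet_Ioi] with x hx r hr
      rw [norm_neg, hnorm _ _ _ hx]
      have hx' : 0 < x := hx
      have hr' : r₀.re / 2 < r.re := hr
      gcongr
    · filter_upwards [ae_restrict_mem measurableSet_Ioi] with x hx r hr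
      have hx' : (x : ℂ) ≠ 0 := Complex.ofReal_ne_zero.2 (ne_of_gt hx)
      have h1 : HasDerivAt (fun r : ℂ => -(r * x)) (-(1 * (x : ℂ))) r :=
        ((hasDerivAt_id r).mul_const (x : ℂ)).neg
      convert! h1.cexp.const_mul ((x : ℂ) ^ (w - 1)) using 1
      rw [Complex.cpow_sub _ _ hx', Complex.cpow_one]
      field_simp
  have hslit : ∀ r : ℂ, 0 < r.re → r ∈ Complex.slitPlane := fun r hr => Or.inl hr
  have key := AnalyticOnNhd.eqOn_of_preconnected_of_frequently_eq (𝕜 := ℂ)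
    (f := fun r : ℂ => ∫ x in Ioi (0 : ℝ), (x : ℂ) ^ (w - 1) * Complex.exp (-(r * x)))
    (g := fun r : ℂ => r ^ (-w) * Complex.Gamma w) (U := {r : ℂ | 0 < r.re}) (z₀ := 1)
    (DifferentiableOn.analyticOnNhd
      (fun r hr => (hderiv r hr).differentiableWithinAt) hopen)
    (DifferentiableOn.analyticOnNhd
      (fun r hr => ((differentiableAt_id.cpow_const (hslit r hr)).mul_const
        _).differentiableWithinAt) hopen)
    (convex_halfSpace_re_gt 0).isPreconnected (by simp) ?_
  · exact key hr
  · have hreal : ∀ y : ℝ, 0 < y →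
        ∫ x in Ioi (0 : ℝ), (x : ℂ) ^ (w - 1) * Complex.exp (-((y : ℂ) * x))
          = (y : ℂ) ^ (-w) * Complex.Gamma w := by
      intro y hy
      rw [Complex.integral_cpow_mul_exp_neg_mul_Ioi hw hy, one_div, Complex.inv_cpow,
        Complex.cpow_neg]
      rw [Complex.arg_ofReal_of_nonneg hy.le]
      exact Real.pi_pos.ne
    have ht : Tendsto (fun n : ℕ => ((1 + 1 / ((n : ℝ) + 1) : ℝ) : ℂ)) atTop (nhdsWithin 1 {1}ᶜ) := by
      refine tendsto_nhdsWithin_iff.2 ⟨?_, Eventually.of_forall fun n => ?_⟩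
      · have := (tendsto_one_div_add_atTop_nhds_zero_nat (𝕜 := ℝ)).const_add 1
        rw [add_zero] at this
        simpa [Function.comp_def] using (Complex.continuous_ofReal.tendsto _).comp this
      · have : (0 : ℝ) < 1 / ((n : ℝ) + 1) := by positivity
        intro h
        have h' : ((1 + 1 / ((n : ℝ) + 1) : ℝ) : ℂ) = ((1 : ℝ) : ℂ) := by simpa using h
        have := Complex.ofReal_injective h'
        linarith
    exact ht.frequently (Frequently.of_forall fun n => hreal _ (by positivity))

theorem norm_cpow_mul_sin {w : ℂ} {a x : ℝ} (hx : 0 < x) :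
    ‖(x : ℂ) ^ w * (Real.sin (a * x) : ℂ)‖ = x ^ w.re * |Real.sin (a * x)| := by
  rw [norm_mul, Complex.norm_cpow_eq_rpow_re_of_pos hx, Complex.norm_real, Real.norm_eq_abs]

theorem continuousOn_cpow_mul_sin (w : ℂ) (a : ℝ) :
    ContinuousOn (fun x : ℝ => (x : ℂ) ^ w * (Real.sin (a * x) : ℂ)) (Ioi 0) := fun x hx =>
  ((Complex.continuousAt_ofReal_cpow_const _ _ (Or.inr (ne_of_gt hx))).mul
    (by fun_prop)).continuousWithinAt

theorem rpow_mul_abs_sin_le {s a x : ℝ} (ha : 0 < a) (hx : 0 < x) :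
    x ^ s * |Real.sin (a * x)| ≤ a * x ^ (s + 1) := by
  have h : |Real.sin (a * x)| ≤ a * x := by
    simpa [abs_of_pos ha, abs_of_pos hx] using Real.abs_sin_le_abs (x := a * x)
  calc x ^ s * |Real.sin (a * x)| ≤ x ^ s * (a * x) := by gcongr
    _ = a * x ^ (s + 1) := by rw [Real.rpow_add_one hx.ne']; ring

theorem integrableOn_Ioi_one_cpow_mul_sin {w : ℂ} (h1 : w.re < 1) (a : ℝ) :
    IntegrableOn (fun x : ℝ => (x : ℂ) ^ (w - 2) * (Real.sin (a * x) : ℂ)) (Ioi 1) := by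
  have hsub : Ioi (1 : ℝ) ⊆ Ioi 0 := Ioi_subset_Ioi zero_le_one
  refine (integrableOn_Ioi_rpow_of_lt (a := w.re - 2) (by linarith) one_pos).mono'
    (((continuousOn_cpow_mul_sin _ a).mono hsub).aestronglyMeasurable measurableSet_Ioi) ?_
  filter_upwards [ae_restrict_mem measurableSet_Ioi] with x hx
  have hx0 : 0 < x := hsub hx
  rw [norm_cpow_mul_sin hx0]
  simpa using mul_le_of_le_one_right (by positivity) (Real.abs_sin_le_one (a * x))

theorem integrableOn_Ioc_cpow_mul_sin {w : ℂ} (h0 : 0 < w.re) {a : ℝ} (ha : 0 < a) :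
    IntegrableOn (fun x : ℝ => (x : ℂ) ^ (w - 2) * (Real.sin (a * x) : ℂ)) (Ioc 0 1) := by
  have hi : IntegrableOn (fun x : ℝ => a * x ^ (w.re - 1)) (Ioc 0 1) :=
    ((intervalIntegrable_iff_integrableOn_Ioc_of_le zero_le_one).1
      (intervalIntegrable_rpow' (by linarith))).const_mul a
  refine hi.mono' (((continuousOn_cpow_mul_sin _ a).mono
    Ioc_subset_Ioi_self).aestronglyMeasurable measurableSet_Ioc) ?_
  filter_upwards [ae_restrict_mem measurableSet_Ioc] with x hx
  rw [norm_cpow_mul_sin hx.1]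
  convert rpow_mul_abs_sin_le (s := (w - 2).re) ha hx.1 using 3
  simp only [Complex.sub_re, Complex.re_ofNat]
  ring

theorem integrableOn_cpow_mul_sin {w : ℂ} (h0 : 0 < w.re) (h1 : w.re < 1) {a : ℝ} (ha : 0 < a) :
    IntegrableOn (fun x : ℝ => (x : ℂ) ^ (w - 2) * (Real.sin (a * x) : ℂ)) (Ioi 0) := by
  rw [← Ioc_union_Ioi_eq_Ioi (zero_le_one' ℝ)]
  exact (integrableOn_Ioc_cpow_mul_sin h0 ha).union (integrableOn_Ioi_one_cpow_mul_sin h1 a)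

theorem one_sub_ne_zero_of_re_lt_one {w : ℂ} (h1 : w.re < 1) : 1 - w ≠ 0 := fun h => by
  have := congrArg Complex.re h
  simp at this
  linarith

theorem integral_cpow_mul_sin_mul_exp_neg {w : ℂ} (h0 : 0 < w.re) (h1 : w.re < 1) {a ε : ℝ}
    (ha : 0 < a) (hε : 0 < ε) :
    ∫ x in Ioi (0 : ℝ), (x : ℂ) ^ (w - 2) * (Real.sin (a * x) : ℂ) * (Real.exp (-(ε * x)) : ℂ)
      = Complex.Gamma w / (2 * Complex.I * (1 - w)) *
        ((ε + a * Complex.I) ^ (1 - w) - (ε - a * Complex.I) ^ (1 - w)) := by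
  set r : ℂ := ε - a * Complex.I with hr
  set r' : ℂ := ε + a * Complex.I with hr'
  have hrre : 0 < r.re := by simpa [hr] using hε
  have hrre' : 0 < r'.re := by simpa [hr'] using hε
  have hr0 : r ≠ 0 := fun h => by simp [h] at hrre
  have hr0' : r' ≠ 0 := fun h => by simp [h] at hrre'
  have hw := one_sub_ne_zero_of_re_lt_one h1
  have hexp : ∀ x : ℝ, Complex.exp (-(r * x)) - Complex.exp (-(r' * x)) =
      2 * Complex.I * ((Real.sin (a * x) : ℂ) * (Real.exp (-(ε * x)) : ℂ)) := by
    intro x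
    have e1 : -(r * x) = -((ε : ℂ) * x) + (a * x : ℂ) * Complex.I := by rw [hr]; ring
    have e2 : -(r' * x) = -((ε : ℂ) * x) + -(a * x : ℂ) * Complex.I := by rw [hr']; ring
    rw [e1, e2, Complex.exp_add, Complex.exp_add, Complex.ofReal_sin, Complex.sin]
    push_cast
    ring_nf
    simp only [Complex.I_sq]
    ring
  have hdamp : ∀ x : ℝ, 0 < x → Real.exp (-(ε * x)) ≤ 1 := fun x hx =>
    Real.exp_le_one_iff.2 (by nlinarith)
  have hint : ∀ s : ℂ, 0 < s.re → IntegrableOn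
      (fun x : ℝ => (x : ℂ) ^ (w - 1) * Complex.exp (-(s * x))) (Ioi 0) := by
    intro s hs
    have h := integrableOn_rpow_mul_exp_neg_mul_rpow (s := w.re - 1) (by linarith) one_pos hs
    refine h.mono' (ContinuousOn.aestronglyMeasurable (fun x hx => ?_) measurableSet_Ioi) ?_
    · exact ((Complex.continuousAt_ofReal_cpow_const _ _ (Or.inr (ne_of_gt hx))).mul
        (by fun_prop)).continuousWithinAt
    · filter_upwards [ae_restrict_mem measurableSet_Ioi] with x hx
      rw [norm_mul, Complex.norm_cpow_eq_rpow_re_of_pos hx, Complex.norm_exp]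
      simp
  have hint0 : IntegrableOn (fun x : ℝ => (x : ℂ) ^ (w - 2) * (Real.sin (a * x) : ℂ) *
      (Real.exp (-(ε * x)) : ℂ)) (Ioi 0) := by
    refine Integrable.mul_bdd (c := 1) (integrableOn_cpow_mul_sin h0 h1 ha) (by fun_prop) ?_
    filter_upwards [ae_restrict_mem measurableSet_Ioi] with x hx
    rw [Complex.norm_real, Real.norm_of_nonneg (Real.exp_nonneg _)]
    exact hdamp x hx
  have hnormF : ∀ x : ℝ, 0 < x →
      ‖(x : ℂ) ^ (w - 1) * (Complex.exp (-(r * x)) - Complex.exp (-(r' * x)))‖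
        ≤ 2 * (x ^ (w.re - 1) * |Real.sin (a * x)|) := by
    intro x hx
    rw [hexp, norm_mul, Complex.norm_cpow_eq_rpow_re_of_pos hx]
    simp only [norm_mul, Complex.norm_real, Complex.norm_I, Complex.sub_re, Complex.one_re,
      Real.norm_eq_abs, Complex.norm_ofNat, mul_one, Real.abs_exp]
    have := mul_le_of_le_one_right (abs_nonneg (Real.sin (a * x))) (hdamp x hx)
    have hp := Real.rpow_nonneg hx.le (w.re - 1)
    nlinarith
  have hsub : IntegrableOn (fun x : ℝ => r' * ((x : ℂ) ^ (w - 1) * Complex.exp (-(r' * x)))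
      - r * ((x : ℂ) ^ (w - 1) * Complex.exp (-(r * x)))) (Ioi 0) :=
    ((hint r' hrre').const_mul _).sub ((hint r hrre).const_mul _)
  have key := integral_Ioi_of_hasDerivAt_of_tendsto (a := (0 : ℝ)) (m := (0 : ℂ))
    (f := fun x : ℝ => (x : ℂ) ^ (w - 1) * (Complex.exp (-(r * x)) - Complex.exp (-(r' * x))))
    (f' := fun x : ℝ => 2 * Complex.I * (w - 1) * ((x : ℂ) ^ (w - 2) * (Real.sin (a * x) : ℂ) *
        (Real.exp (-(ε * x)) : ℂ)) +
      (r' * ((x : ℂ) ^ (w - 1) * Complex.exp (-(r' * x)))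
        - r * ((x : ℂ) ^ (w - 1) * Complex.exp (-(r * x)))))
    ?_ ?_ ((hint0.const_mul _).add hsub) ?_
  · rw [integral_add (hint0.const_mul _) hsub, integral_sub ((hint r' hrre').const_mul _)
      ((hint r hrre).const_mul _), MeasureTheory.integral_const_mul,
      MeasureTheory.integral_const_mul, MeasureTheory.integral_const_mul,
      integral_cpow_mul_cexp_neg_mul_Ioi h0 hrre, integral_cpow_mul_cexp_neg_mul_Ioi h0 hrre'] at key
    have hp : r * r ^ (-w) = r ^ (1 - w) := by
      rw [sub_eq_add_neg, Complex.cpow_add _ _ hr0, Complex.cpow_one]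
    have hp' : r' * r' ^ (-w) = r' ^ (1 - w) := by
      rw [sub_eq_add_neg, Complex.cpow_add _ _ hr0', Complex.cpow_one]
    rw [← mul_assoc, ← mul_assoc, hp, hp'] at key
    simp only [Complex.ofReal_zero, mul_zero, neg_zero, sub_self] at key
    generalize (∫ x in Ioi (0 : ℝ), (x : ℂ) ^ (w - 2) * (Real.sin (a * x) : ℂ) *
      (Real.exp (-(ε * x)) : ℂ)) = J at key ⊢
    have hI := Complex.I_ne_zero
    field_simp
    linear_combination -key
  · have hzero : ((0 : ℝ) : ℂ) ^ (w - 1) *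
        (Complex.exp (-(r * (0 : ℝ))) - Complex.exp (-(r' * (0 : ℝ)))) = 0 := by simp
    rw [← continuousWithinAt_Ioi_iff_Ici, ContinuousWithinAt, hzero]
    have hlim : Tendsto (fun x : ℝ => 2 * (a * x ^ w.re)) (nhdsWithin 0 (Ioi 0)) (nhds 0) := by
      have h := (Real.continuousAt_rpow_const 0 w.re (Or.inr h0.le)).tendsto
      rw [Real.zero_rpow h0.ne'] at h
      simpa using ((h.const_mul a).const_mul 2).mono_left nhdsWithin_le_nhds
    refine squeeze_zero_norm' ?_ hlim
    filter_upwards [self_mem_nhdsWithin] with x hx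
    refine (hnormF x hx).trans ?_
    have := rpow_mul_abs_sin_le (s := w.re - 1) ha hx
    rw [sub_add_cancel] at this
    gcongr
  · intro x hx
    have hx0 : (x : ℂ) ≠ 0 := Complex.ofReal_ne_zero.2 (ne_of_gt hx)
    have hd : ∀ s : ℂ, HasDerivAt (fun x : ℝ => Complex.exp (-(s * x)))
        (Complex.exp (-(s * x)) * (-(s * 1))) x := fun s =>
      (((Complex.ofRealCLM.hasDerivAt (x := x)).const_mul s).neg).cexp
    have hd1 := hasDerivAt_ofReal_cpow_const (ne_of_gt hx) (r := w - 1)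
      (fun h => hw (by linear_combination -h))
    convert! hd1.mul ((hd r).sub (hd r')) using 1
    simp only [Pi.sub_apply]
    rw [hexp, show w - 1 - 1 = w - 2 by ring]
    ring
  · have hlim : Tendsto (fun x : ℝ => 2 * x ^ (w.re - 1)) atTop (nhds 0) := by
      have := tendsto_rpow_neg_atTop (y := 1 - w.re) (by linarith)
      simpa using this.const_mul 2
    refine squeeze_zero_norm' ?_ hlim
    filter_upwards [Ioi_mem_atTop 0] with x hx
    refine (hnormF x hx).trans ?_
    have := mul_le_of_le_one_right (Real.rpow_nonneg (le_of_lt hx) (w.re - 1))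
      (Real.abs_sin_le_one (a * x))
    gcongr

theorem mul_I_cpow_sub_neg_mul_I_cpow {a : ℝ} (ha : 0 < a) (s : ℂ) :
    (a * Complex.I) ^ s - (-(a * Complex.I)) ^ s =
      2 * Complex.I * (a : ℂ) ^ s * Complex.sin (Real.pi * s / 2) := by
  have ha' : (a : ℂ) ≠ 0 := Complex.ofReal_ne_zero.2 ha.ne'
  rw [show -(a * Complex.I) = a * (-Complex.I) by ring,
    Complex.cpow_def_of_ne_zero (mul_ne_zero ha' Complex.I_ne_zero),
    Complex.cpow_def_of_ne_zero (mul_ne_zero ha' (neg_ne_zero.2 Complex.I_ne_zero)),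
    Complex.cpow_def_of_ne_zero ha',
    Complex.log_ofReal_mul ha Complex.I_ne_zero,
    Complex.log_ofReal_mul ha (neg_ne_zero.2 Complex.I_ne_zero), Complex.log_I, Complex.log_neg_I,
    ← Complex.ofReal_log ha.le, add_mul, add_mul, Complex.exp_add, Complex.exp_add, Complex.sin]
  rw [show (Real.pi : ℂ) / 2 * Complex.I * s = Real.pi * s / 2 * Complex.I by ring,
    show -((Real.pi : ℂ) / 2) * Complex.I * s = -(Real.pi * s / 2) * Complex.I by ring]
  ring_nf
  simp only [Complex.I_sq]
  ring

/-- The Mellin transform of the sine, in the strip `-1 < Re s < 0` for `s = w - 1`. -/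
theorem integral_cpow_mul_sin {w : ℂ} (h0 : 0 < w.re) (h1 : w.re < 1) {a : ℝ} (ha : 0 < a) :
    ∫ x in Ioi (0 : ℝ), (x : ℂ) ^ (w - 2) * (Real.sin (a * x) : ℂ)
      = (a : ℂ) ^ (1 - w) * Complex.Gamma w * Complex.cos (Real.pi * w / 2) / (1 - w) := by
  have hint := integrableOn_cpow_mul_sin h0 h1 ha
  have hlim : Tendsto (fun ε : ℝ => ∫ x in Ioi (0 : ℝ), (x : ℂ) ^ (w - 2) *
      (Real.sin (a * x) : ℂ) * (Real.exp (-(ε * x)) : ℂ)) (nhdsWithin 0 (Ioi 0))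
      (nhds (∫ x in Ioi (0 : ℝ), (x : ℂ) ^ (w - 2) * (Real.sin (a * x) : ℂ))) := by
    refine tendsto_integral_filter_of_dominated_convergence _
      (Eventually.of_forall fun ε => hint.aestronglyMeasurable.mul
        (by fun_prop)) ?_ hint.norm (Eventually.of_forall fun x => ?_)
    · filter_upwards [self_mem_nhdsWithin] with ε hε
      filter_upwards [ae_restrict_mem measurableSet_Ioi] with x hx
      rw [norm_mul _ (Real.exp (-(ε * x)) : ℂ)]
      refine mul_le_of_le_one_right (norm_nonneg _) ?_
      rw [Complex.norm_real, Real.norm_of_nonneg (Real.exp_nonneg _), Real.exp_le_one_iff]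
      have := mul_pos (mem_Ioi.1 hε) (mem_Ioi.1 hx)
      linarith
    · have hc : Continuous fun ε : ℝ => (x : ℂ) ^ (w - 2) * (Real.sin (a * x) : ℂ) *
          (Real.exp (-(ε * x)) : ℂ) := by fun_prop
      simpa using (hc.tendsto 0).mono_left nhdsWithin_le_nhds
  have hlim' : Tendsto (fun ε : ℝ => Complex.Gamma w / (2 * Complex.I * (1 - w)) *
      ((ε + a * Complex.I) ^ (1 - w) - (ε - a * Complex.I) ^ (1 - w))) (nhdsWithin 0 (Ioi 0))
      (nhds (Complex.Gamma w / (2 * Complex.I * (1 - w)) *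
        ((a * Complex.I) ^ (1 - w) - (-(a * Complex.I)) ^ (1 - w)))) := by
    have hs : (a * Complex.I : ℂ) ∈ Complex.slitPlane := Or.inr (by simpa using ha.ne')
    have hs' : (-(a * Complex.I) : ℂ) ∈ Complex.slitPlane := Or.inr (by simpa using ha.ne')
    have t1 : Tendsto (fun ε : ℝ => (ε + a * Complex.I : ℂ)) (nhdsWithin 0 (Ioi 0))
        (nhds (a * Complex.I)) := by
      have hc : Continuous fun ε : ℝ => (ε + a * Complex.I : ℂ) := by fun_prop
      simpa using (hc.tendsto 0).mono_left nhdsWithin_le_nhds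
    have t2 : Tendsto (fun ε : ℝ => (ε - a * Complex.I : ℂ)) (nhdsWithin 0 (Ioi 0))
        (nhds (-(a * Complex.I))) := by
      have hc : Continuous fun ε : ℝ => (ε - a * Complex.I : ℂ) := by fun_prop
      simpa using (hc.tendsto 0).mono_left nhdsWithin_le_nhds
    exact (((continuousAt_cpow_const hs).tendsto.comp t1).sub
      ((continuousAt_cpow_const hs').tendsto.comp t2)).const_mul _
  have hcongr : (fun ε : ℝ => ∫ x in Ioi (0 : ℝ), (x : ℂ) ^ (w - 2) *
      (Real.sin (a * x) : ℂ) * (Real.exp (-(ε * x)) : ℂ)) =ᶠ[nhdsWithin 0 (Ioi 0)]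
      fun ε : ℝ => Complex.Gamma w / (2 * Complex.I * (1 - w)) *
      ((ε + a * Complex.I) ^ (1 - w) - (ε - a * Complex.I) ^ (1 - w)) := by
    filter_upwards [self_mem_nhdsWithin] with ε hε
    exact integral_cpow_mul_sin_mul_exp_neg h0 h1 ha hε
  rw [tendsto_nhds_unique hlim (hlim'.congr' hcongr.symm), mul_I_cpow_sub_neg_mul_I_cpow ha,
    show (Real.pi : ℂ) * (1 - w) / 2 = Real.pi / 2 - Real.pi * w / 2 by ring,
    Complex.sin_pi_div_two_sub]
  have hI := Complex.I_ne_zero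
  have hw := one_sub_ne_zero_of_re_lt_one h1
  field_simp

/-- An absolutely convergent form of `φ_{w,0}(t)`, obtained by integrating by parts. -/
noncomputable def hardyPhi (w : ℂ) (t : ℝ) : ℂ :=
  ((Real.sin (2 * Real.pi * t) : ℂ) +
    w * ∫ x in Ioi (1 : ℝ), (x : ℂ) ^ (w - 2) * (Real.sin (2 * Real.pi * t * x) : ℂ)) /
      (Real.pi * t)

theorem hasDerivAt_mul_sin_div {a b v : ℝ} (hv : 0 < v) :
    HasDerivAt (fun x : ℝ => x * Real.sin (a / x) / b)
      ((Real.sin (a / v) - a / v * Real.cos (a / v)) / b) v := by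
  have h1 : HasDerivAt (fun x : ℝ => a / x) (a * -(v ^ 2)⁻¹) v := (hasDerivAt_inv hv.ne').const_mul a
  convert! ((hasDerivAt_id v).mul h1.sin).div_const b using 1
  simp only [id]
  field_simp
  ring

theorem hasDerivAt_integral_cpow_mul_sin_inv (w : ℂ) (a : ℝ) {v : ℝ} (hv : 0 < v) :
    HasDerivAt (fun v : ℝ => ∫ x in (1 : ℝ)..v⁻¹, (x : ℂ) ^ (w - 2) * (Real.sin (a * x) : ℂ))
      (-((v : ℂ) ^ (-w) * (Real.sin (a / v) : ℂ))) v := by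
  have hv' : 0 < v⁻¹ := inv_pos.2 hv
  have hc := continuousOn_cpow_mul_sin (w - 2) a
  have hsub : uIcc 1 v⁻¹ ⊆ Ioi (0 : ℝ) := fun x hx => (lt_min one_pos hv').trans_le hx.1
  have h := integral_hasDerivAt_right (hc.mono hsub).intervalIntegrable
    (hc.stronglyMeasurableAtFilter isOpen_Ioi _ hv') (hc.continuousAt (Ioi_mem_nhds hv'))
  convert! h.scomp v (hasDerivAt_inv hv.ne') using 1
  have hv0 : (v : ℂ) ≠ 0 := Complex.ofReal_ne_zero.2 hv.ne'
  rw [Complex.ofReal_inv, Complex.inv_cpow _ _ (by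
    rw [Complex.arg_ofReal_of_nonneg hv.le]; exact Real.pi_pos.ne), ← Complex.cpow_neg,
    show -(w - 2) = -w + 2 by ring, Complex.cpow_add _ _ hv0, Complex.real_smul]
  push_cast
  rw [Complex.cpow_ofNat, div_eq_mul_inv]
  field_simp

theorem hardyPhi_isLimit {w : ℂ} (h1 : w.re < 1) {t : ℝ} (ht : 0 < t) :
    Tendsto (fun δ : ℝ => ∫ v in δ..1, (v : ℂ) ^ (-w) *
      ((deriv (fun x : ℝ => x * Real.sin (2 * Real.pi * t / x) / (Real.pi * t)) v : ℝ) : ℂ))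
      (nhdsWithin 0 (Ioi 0)) (nhds (hardyPhi w t)) := by
  set a := 2 * Real.pi * t with ha
  have hπt : (Real.pi * t : ℂ) ≠ 0 := by
    exact_mod_cast (mul_pos Real.pi_pos ht).ne'
  set Ψ : ℝ → ℂ := fun X => ∫ x in (1 : ℝ)..X, (x : ℂ) ^ (w - 2) * (Real.sin (a * x) : ℂ) with hΨ
  set Q : ℝ → ℂ := fun v => (v : ℂ) ^ (1 - w) * (Real.sin (a / v) : ℂ) with hQ
  have hQlim : Tendsto Q (nhdsWithin 0 (Ioi 0)) (nhds 0) := by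
    have hlim : Tendsto (fun x : ℝ => x ^ (1 - w.re)) (nhdsWithin 0 (Ioi 0)) (nhds 0) := by
      have h := (Real.continuousAt_rpow_const 0 (1 - w.re) (Or.inr (by linarith))).tendsto
      rw [Real.zero_rpow (by linarith)] at h
      exact h.mono_left nhdsWithin_le_nhds
    refine squeeze_zero_norm' ?_ hlim
    filter_upwards [self_mem_nhdsWithin] with x hx
    rw [hQ, norm_mul, Complex.norm_cpow_eq_rpow_re_of_pos hx, Complex.norm_real]
    simpa using mul_le_of_le_one_right (Real.rpow_nonneg (le_of_lt hx) (1 - w.re))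
      (Real.abs_sin_le_one (a / x))
  have hΨlim : Tendsto (fun δ : ℝ => Ψ δ⁻¹) (nhdsWithin 0 (Ioi 0))
      (nhds (∫ x in Ioi (1 : ℝ), (x : ℂ) ^ (w - 2) * (Real.sin (a * x) : ℂ))) :=
    intervalIntegral_tendsto_integral_Ioi 1 (integrableOn_Ioi_one_cpow_mul_sin h1 a)
      tendsto_inv_nhdsGT_zero
  have hFTC : ∀ δ : ℝ, 0 < δ → δ < 1 → ∫ v in δ..1, (v : ℂ) ^ (-w) *
      ((deriv (fun x : ℝ => x * Real.sin (a / x) / (Real.pi * t)) v : ℝ) : ℂ)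
      = ((Real.sin a : ℂ) - Q δ + w * Ψ δ⁻¹) / (Real.pi * t) := by
    intro δ hδ hδ1
    have hpos : ∀ v ∈ uIcc δ 1, 0 < v := fun v hv => by
      rw [uIcc_of_le hδ1.le] at hv
      exact hδ.trans_le hv.1
    have hcongr : ∫ v in δ..1, (v : ℂ) ^ (-w) *
        ((deriv (fun x : ℝ => x * Real.sin (a / x) / (Real.pi * t)) v : ℝ) : ℂ)
        = ∫ v in δ..1, (v : ℂ) ^ (-w) *
          (((Real.sin (a / v) - a / v * Real.cos (a / v)) / (Real.pi * t) : ℝ) : ℂ) :=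
      integral_congr fun v hv => by
        simp only [(hasDerivAt_mul_sin_div (hpos v hv)).deriv]
    rw [hcongr, integral_eq_sub_of_hasDerivAt
      (f := fun v => (Q v - w * Ψ v⁻¹) / (Real.pi * t)) (fun v hv => ?_)
      (ContinuousOn.intervalIntegrable fun v hv => ?_)]
    · simp [hQ, hΨ]
      ring
    · have hv0 := hpos v hv
      have hvc : (v : ℂ) ≠ 0 := Complex.ofReal_ne_zero.2 hv0.ne'
      have hd1 := hasDerivAt_ofReal_cpow_const hv0.ne' (one_sub_ne_zero_of_re_lt_one h1)
      have hi : HasDerivAt (fun x : ℝ => a / x) (a * -(v ^ 2)⁻¹) v :=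
        (hasDerivAt_inv hv0.ne').const_mul a
      have hd2 := hi.sin.ofReal_comp
      convert! ((hd1.mul hd2).sub
        ((hasDerivAt_integral_cpow_mul_sin_inv w a hv0).const_mul w)).div_const
          (Real.pi * t : ℂ) using 1
      rw [show 1 - w - 1 = -w by ring, sub_eq_add_neg 1 w, Complex.cpow_add _ _ hvc,
        Complex.cpow_one]
      push_cast
      field_simp
      ring
    · have hv0 := hpos v hv
      have hr : ContinuousAt (fun v : ℝ =>
          (Real.sin (a / v) - a / v * Real.cos (a / v)) / (Real.pi * t)) v := by
        fun_prop (disch := exact hv0.ne')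
      exact ((Complex.continuousAt_ofReal_cpow_const _ _ (Or.inr hv0.ne')).mul
        (Complex.continuous_ofReal.continuousAt.comp hr)).continuousWithinAt
  have hlim := (((hQlim.const_sub (Real.sin a : ℂ)).add (hΨlim.const_mul w)).div_const
    (Real.pi * t : ℂ))
  rw [sub_zero] at hlim
  refine hlim.congr' ?_
  filter_upwards [Ioo_mem_nhdsGT one_pos] with δ hδ
  exact (hFTC δ hδ.1 hδ.2).symm

theorem continuousOn_hardyPhi {w : ℂ} (h1 : w.re < 1) : ContinuousOn (hardyPhi w) (Ioi 0) := by
  have hc : Continuous fun t : ℝ => ∫ x in Ioi (1 : ℝ),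
      (x : ℂ) ^ (w - 2) * (Real.sin (2 * Real.pi * t * x) : ℂ) := by
    refine continuous_of_dominated (bound := fun x => ‖(x : ℂ) ^ (w - 2)‖)
      (fun t => (integrableOn_Ioi_one_cpow_mul_sin h1 _).aestronglyMeasurable)
      (fun t => Eventually.of_forall fun x => ?_)
      (integrableOn_Ioi_cpow_of_lt (by simp; linarith) one_pos).norm
      (Eventually.of_forall fun x => by fun_prop)
    rw [norm_mul, Complex.norm_real]
    exact mul_le_of_le_one_right (norm_nonneg _) (Real.abs_sin_le_one _)
  refine ContinuousOn.div (by fun_prop) (by fun_prop) fun t ht => ?_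
  exact_mod_cast (mul_pos Real.pi_pos ht).ne'

theorem norm_hardyPhi_le {w : ℂ} (h1 : w.re < 1) {t : ℝ} (ht : 0 < t) :
    ‖hardyPhi w t‖ ≤ (1 + ‖w‖ / (1 - w.re)) / t := by
  have hI : ‖∫ x in Ioi (1 : ℝ), (x : ℂ) ^ (w - 2) * (Real.sin (2 * Real.pi * t * x) : ℂ)‖
      ≤ 1 / (1 - w.re) := by
    have h : ∫ x in Ioi (1 : ℝ), x ^ (w.re - 2) = 1 / (1 - w.re) := by
      rw [integral_Ioi_rpow_of_lt (by linarith) one_pos, Real.one_rpow,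
        show w.re - 2 + 1 = -(1 - w.re) by ring, neg_div_neg_eq]
    rw [← h]
    refine norm_integral_le_of_norm_le
      (integrableOn_Ioi_rpow_of_lt (by linarith) one_pos) ?_
    filter_upwards [ae_restrict_mem measurableSet_Ioi] with x hx
    have hx0 : (0 : ℝ) < x := one_pos.trans hx
    rw [norm_cpow_mul_sin hx0]
    simpa using mul_le_of_le_one_right (Real.rpow_nonneg hx0.le (w.re - 2))
      (Real.abs_sin_le_one (2 * Real.pi * t * x))
  have hσ : 0 < 1 - w.re := by linarith
  have hn : ‖(Real.pi * t : ℂ)‖ = Real.pi * t := by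
    rw [norm_mul, Complex.norm_real, Complex.norm_real, Real.norm_of_nonneg Real.pi_pos.le,
      Real.norm_of_nonneg ht.le]
  rw [hardyPhi, norm_div, hn]
  have hπ : t ≤ Real.pi * t := by nlinarith [Real.pi_gt_three]
  gcongr
  refine (norm_add_le _ _).trans (add_le_add ?_ ?_)
  · rw [Complex.norm_real]
    exact Real.abs_sin_le_one _
  · rw [norm_mul, div_eq_mul_one_div]
    gcongr

theorem abs_mul_cos_sub_sin_le {y : ℝ} (hy : 0 ≤ y) : |y * Real.cos y - Real.sin y| ≤ y ^ 2 := by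
  have hd : ∀ x ∈ Icc 0 y, HasDerivWithinAt (fun x : ℝ => x * Real.cos x - Real.sin x)
      (-(x * Real.sin x)) (Icc 0 y) x := fun x _ => by
    convert! (((hasDerivAt_id x).mul (Real.hasDerivAt_cos x)).sub
      (Real.hasDerivAt_sin x)).hasDerivWithinAt using 1
    simp
  have h := (convex_Icc 0 y).norm_image_sub_le_of_norm_hasDerivWithin_le (C := y) hd
    (fun x hx => ?_) (left_mem_Icc.2 hy) (right_mem_Icc.2 hy)
  · simpa [abs_of_nonneg hy, sq] using h
  · rw [norm_neg, norm_mul, Real.norm_of_nonneg hx.1]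
    calc x * ‖Real.sin x‖ ≤ y * 1 :=
          mul_le_mul hx.2 (Real.abs_sin_le_one x) (norm_nonneg _) hy
      _ = y := mul_one y

/-- Integration by parts on `(0,1]`: the error term is bounded uniformly in the strip. -/
theorem norm_sin_sub_integral_le {w : ℂ} (h0 : 0 < w.re) (h1 : w.re < 1) {a : ℝ} (ha : 0 < a) :
    ‖(Real.sin a : ℂ) - w * ∫ x in Ioc (0 : ℝ) 1, (x : ℂ) ^ (w - 2) * (Real.sin (a * x) : ℂ)‖
      ≤ a ^ 2 := by
  have hsin := (intervalIntegrable_iff_integrableOn_Ioc_of_le zero_le_one).2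
    (integrableOn_Ioc_cpow_mul_sin h0 ha)
  have hbd : ∀ x : ℝ, x ∈ Ioc (0 : ℝ) 1 → ‖(x : ℂ) ^ (w - 2) *
      ((a * x * Real.cos (a * x) - Real.sin (a * x) : ℝ) : ℂ)‖ ≤ a ^ 2 := by
    intro x hx
    rw [norm_mul, Complex.norm_cpow_eq_rpow_re_of_pos hx.1, Complex.norm_real, Real.norm_eq_abs]
    have hp : x ^ (w - 2).re * (a * x) ^ 2 = a ^ 2 * x ^ w.re := by
      rw [Complex.sub_re, Complex.re_ofNat, Real.rpow_sub hx.1, Real.rpow_two]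
      have := hx.1.ne'
      field_simp
    calc _ ≤ x ^ (w - 2).re * (a * x) ^ 2 := by
          have := hx.1
          gcongr
          exact abs_mul_cos_sub_sin_le (by positivity)
      _ = a ^ 2 * x ^ w.re := hp
      _ ≤ a ^ 2 := mul_le_of_le_one_right (sq_nonneg a) (Real.rpow_le_one hx.1.le hx.2 h0.le)
  have hrest : IntervalIntegrable (fun x : ℝ => (x : ℂ) ^ (w - 2) *
      ((a * x * Real.cos (a * x) - Real.sin (a * x) : ℝ) : ℂ)) volume 0 1 := by
    rw [intervalIntegrable_iff_integrableOn_Ioc_of_le zero_le_one]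
    refine Integrable.mono' (integrableOn_const (C := a ^ 2) (by simp))
      (ContinuousOn.aestronglyMeasurable (fun x hx => ?_) measurableSet_Ioc) ?_
    · exact ((Complex.continuousAt_ofReal_cpow_const _ _ (Or.inr hx.1.ne')).mul
        (by fun_prop)).continuousWithinAt
    · filter_upwards [ae_restrict_mem measurableSet_Ioc] with x hx
      exact hbd x hx
  have key := integral_eq_sub_of_hasDerivAt_of_le (zero_le_one' ℝ)
    (f := fun x : ℝ => (x : ℂ) ^ (w - 1) * (Real.sin (a * x) : ℂ))
    (f' := fun x : ℝ => w * ((x : ℂ) ^ (w - 2) * (Real.sin (a * x) : ℂ)) + (x : ℂ) ^ (w - 2) *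
      ((a * x * Real.cos (a * x) - Real.sin (a * x) : ℝ) : ℂ)) ?_ ?_
    ((hsin.const_mul w).add hrest)
  · rw [integral_add (hsin.const_mul w) hrest, intervalIntegral.integral_const_mul] at key
    rw [← integral_of_le zero_le_one]
    have e : (Real.sin a : ℂ) - w * ∫ x in (0 : ℝ)..1, (x : ℂ) ^ (w - 2) *
        (Real.sin (a * x) : ℂ) = ∫ x in (0 : ℝ)..1, (x : ℂ) ^ (w - 2) *
      ((a * x * Real.cos (a * x) - Real.sin (a * x) : ℝ) : ℂ) := by
      simp only [mul_one, mul_zero, Real.sin_zero, Complex.ofReal_zero, sub_zero,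
        Complex.ofReal_one, Complex.one_cpow, one_mul] at key
      rw [← key]
      ring
    rw [e]
    simpa using norm_integral_le_of_norm_le_const (a := (0 : ℝ)) (b := 1) (C := a ^ 2)
      (fun x hx => hbd x (by rwa [uIoc_of_le zero_le_one] at hx))
  · intro x hx
    rcases hx.1.eq_or_lt with rfl | hx0
    · have hlim : Tendsto (fun x : ℝ => a * x ^ w.re) (nhdsWithin 0 (Ioi 0)) (nhds 0) := by
        have h := (Real.continuousAt_rpow_const 0 w.re (Or.inr h0.le)).tendsto
        rw [Real.zero_rpow h0.ne'] at h
        simpa using (h.const_mul a).mono_left nhdsWithin_le_nhds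
      have hz : ContinuousWithinAt (fun x : ℝ => (x : ℂ) ^ (w - 1) * (Real.sin (a * x) : ℂ))
          (Ici 0) 0 := by
        have hzero : ((0 : ℝ) : ℂ) ^ (w - 1) * (Real.sin (a * 0) : ℂ) = 0 := by simp
        rw [← continuousWithinAt_Ioi_iff_Ici, ContinuousWithinAt, hzero]
        refine squeeze_zero_norm' ?_ hlim
        filter_upwards [self_mem_nhdsWithin] with x hx
        rw [norm_cpow_mul_sin hx]
        simpa using rpow_mul_abs_sin_le (s := w.re - 1) ha hx
      exact hz.mono Icc_subset_Ici_self
    · exact ((continuousOn_cpow_mul_sin _ a).continuousAt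
        (Ioi_mem_nhds hx0)).continuousWithinAt
  · intro x hx
    have hx0 : (x : ℂ) ≠ 0 := Complex.ofReal_ne_zero.2 hx.1.ne'
    have hd1 := hasDerivAt_ofReal_cpow_const hx.1.ne' (r := w - 1)
      (fun h => one_sub_ne_zero_of_re_lt_one h1 (by linear_combination -h))
    have hd2 := ((hasDerivAt_id x).const_mul a).sin.ofReal_comp
    convert! hd1.mul hd2 using 1
    rw [show w - 1 - 1 = w - 2 by ring, show w - 1 = w - 2 + 1 by ring, Complex.cpow_add _ _ hx0,
      Complex.cpow_one]
    simp only [id]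
    push_cast
    ring

theorem baezDuarteU_mul_cpow {w : ℂ} (h1 : w.re < 1) {t : ℝ} (ht : 0 < t) :
    baezDuarteU w * (t : ℂ) ^ (-w) = w * (((2 * Real.pi * t : ℝ) : ℂ) ^ (1 - w) *
      Complex.Gamma w * Complex.cos (Real.pi * w / 2) / (1 - w)) / (Real.pi * t) := by
  have hw := one_sub_ne_zero_of_re_lt_one h1
  have hπ : (Real.pi : ℂ) ≠ 0 := Complex.ofReal_ne_zero.2 Real.pi_pos.ne'
  have htc : (t : ℂ) ≠ 0 := Complex.ofReal_ne_zero.2 ht.ne'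
  have e : ((2 * Real.pi * t : ℝ) : ℂ) ^ (1 - w) =
      2 ^ (1 - w) * (Real.pi * (Real.pi : ℂ) ^ (-w)) * (t * (t : ℂ) ^ (-w)) := by
    rw [Complex.ofReal_mul, Complex.mul_cpow_ofReal_nonneg (by positivity) ht.le,
      Complex.ofReal_mul, Complex.mul_cpow_ofReal_nonneg (by positivity) Real.pi_pos.le,
      Complex.ofReal_ofNat, sub_eq_add_neg, Complex.cpow_add _ _ hπ, Complex.cpow_add _ _ htc,
      Complex.cpow_one, Complex.cpow_one]
  rw [e, baezDuarteU]
  field_simp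

theorem norm_hardyPhi_sub_le {w : ℂ} (h0 : 0 < w.re) (h1 : w.re < 1) {t : ℝ} (ht : 0 < t) :
    ‖hardyPhi w t - baezDuarteU w * (t : ℂ) ^ (-w)‖ ≤ 4 * Real.pi * t := by
  have ha : 0 < 2 * Real.pi * t := by positivity
  have hsplit := integral_cpow_mul_sin h0 h1 ha
  rw [← Ioc_union_Ioi_eq_Ioi (zero_le_one' ℝ), setIntegral_union (Ioc_disjoint_Ioi le_rfl)
    measurableSet_Ioi (integrableOn_Ioc_cpow_mul_sin h0 ha)
    (integrableOn_Ioi_one_cpow_mul_sin h1 _)] at hsplit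
  have hn : ‖(Real.pi * t : ℂ)‖ = Real.pi * t := by
    rw [norm_mul, Complex.norm_real, Complex.norm_real, Real.norm_of_nonneg Real.pi_pos.le,
      Real.norm_of_nonneg ht.le]
  rw [baezDuarteU_mul_cpow h1 ht, ← hsplit, hardyPhi, ← sub_div, norm_div, hn,
    div_le_iff₀ (by positivity)]
  refine (le_of_eq ?_).trans ((norm_sin_sub_integral_le h0 h1 ha).trans (le_of_eq (by ring)))
  congr 1
  ring

/-- Iterates of the Hardy averaging operator applied to `φ_{w,0}`. -/
noncomputable def hardyIterate : ℕ → ℂ → ℝ → ℂ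
  | 0, w => hardyPhi w
  | L + 1, w => fun t => (∫ u in Ioc (0 : ℝ) t, hardyIterate L w u) / (t : ℂ)

theorem integrableOn_of_norm_sub_cpow_le {f : ℝ → ℂ} {w c : ℂ} {C : ℝ} (h1 : w.re < 1)
    (hf : ContinuousOn f (Ioi 0))
    (hC : ∀ t : ℝ, 0 < t → t ≤ 1 → ‖f t - c * (t : ℂ) ^ (-w)‖ ≤ C) (t : ℝ) :
    IntegrableOn f (Ioc 0 t) := by
  have h01 : IntegrableOn f (Ioc 0 1) := by
    have hp : IntegrableOn (fun t : ℝ => c * (t : ℂ) ^ (-w)) (Ioc 0 1) :=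
      ((intervalIntegrable_iff_integrableOn_Ioc_of_le zero_le_one).1
        (intervalIntegrable_cpow' (by simpa using h1))).const_mul c
    have hfm : AEStronglyMeasurable f (volume.restrict (Ioc 0 1)) :=
      (hf.mono Ioc_subset_Ioi_self).aestronglyMeasurable measurableSet_Ioc
    have hd : IntegrableOn (fun t : ℝ => f t - c * (t : ℂ) ^ (-w)) (Ioc 0 1) := by
      refine Integrable.mono' (integrableOn_const (C := C) (by simp))
        (hfm.sub hp.aestronglyMeasurable) ?_
      filter_upwards [ae_restrict_mem measurableSet_Ioc] with t ht
      exact hC t ht.1 ht.2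
    exact (hd.add hp).congr (Eventually.of_forall fun t => sub_add_cancel _ _)
  have h1t : IntegrableOn f (Icc 1 t) :=
    (hf.mono fun x hx => one_pos.trans_le hx.1).integrableOn_Icc
  refine (h01.union h1t).mono_set fun x hx => ?_
  rcases le_total x 1 with h | h
  · exact Or.inl ⟨hx.1, h⟩
  · exact Or.inr ⟨h, hx.2⟩

theorem continuousOn_integral_Ioc_div {f : ℝ → ℂ} (hf : ∀ t, IntegrableOn f (Ioc 0 t)) :
    ContinuousOn (fun t : ℝ => (∫ u in Ioc (0 : ℝ) t, f u) / (t : ℂ)) (Ioi 0) := by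
  refine ContinuousOn.div (fun t ht => ?_) (by fun_prop)
    fun t ht => Complex.ofReal_ne_zero.2 (ne_of_gt ht)
  have h := continuousOn_primitive ((integrableOn_Icc_iff_integrableOn_Ioc (by simp)).2 (hf (t + 1)))
  exact (h.continuousAt (Icc_mem_nhds ht (lt_add_one t))).continuousWithinAt

theorem norm_integral_Ioc_div_sub_le {f : ℝ → ℂ} {w c : ℂ} {C : ℝ} (h1 : w.re < 1)
    (hf : ContinuousOn f (Ioi 0))
    (hC : ∀ t : ℝ, 0 < t → t ≤ 1 → ‖f t - c * (t : ℂ) ^ (-w)‖ ≤ C) {t : ℝ} (ht : 0 < t)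
    (ht1 : t ≤ 1) :
    ‖(∫ u in Ioc (0 : ℝ) t, f u) / (t : ℂ) - 1 / (1 - w) * c * (t : ℂ) ^ (-w)‖ ≤ C := by
  have hfi := integrableOn_of_norm_sub_cpow_le h1 hf hC t
  have hre : -1 < (-w).re := by simpa using h1
  have hp : IntegrableOn (fun u : ℝ => c * (u : ℂ) ^ (-w)) (Ioc 0 t) :=
    ((intervalIntegrable_iff_integrableOn_Ioc_of_le ht.le).1
      (intervalIntegrable_cpow' hre)).const_mul c
  have hw := one_sub_ne_zero_of_re_lt_one h1
  have htc : (t : ℂ) ≠ 0 := Complex.ofReal_ne_zero.2 ht.ne'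
  have hval : ∫ u in Ioc (0 : ℝ) t, c * (u : ℂ) ^ (-w) = c * (t * (t : ℂ) ^ (-w) / (1 - w)) := by
    rw [MeasureTheory.integral_const_mul, ← integral_of_le ht.le, integral_cpow (Or.inl hre),
      show -w + 1 = 1 + -w by ring, Complex.cpow_add _ _ htc, Complex.cpow_one, Complex.ofReal_zero,
      Complex.zero_cpow (by rwa [← sub_eq_add_neg]), sub_zero, ← sub_eq_add_neg]
  have e : (∫ u in Ioc (0 : ℝ) t, f u) / (t : ℂ) - 1 / (1 - w) * c * (t : ℂ) ^ (-w)
      = (∫ u in Ioc (0 : ℝ) t, (f u - c * (u : ℂ) ^ (-w))) / t := by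
    rw [integral_sub hfi hp, hval]
    field_simp
  rw [e, norm_div, Complex.norm_real, Real.norm_of_nonneg ht.le, div_le_iff₀ ht]
  have hb := norm_setIntegral_le_of_norm_le_const (μ := volume) (s := Ioc 0 t)
    (f := fun u : ℝ => f u - c * (u : ℂ) ^ (-w)) (C := C) (by simp)
    fun u hu => hC u hu.1 (hu.2.trans ht1)
  simpa [Measure.real, ht.le] using hb

theorem hardyIterate_near_zero (L : ℕ) : ∃ C : ℝ, ∀ w : ℂ, 0 < w.re → w.re < 1 →
    ContinuousOn (hardyIterate L w) (Ioi 0) ∧ ∀ t : ℝ, 0 < t → t ≤ 1 →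
      ‖hardyIterate L w t - (1 / (1 - w)) ^ L * baezDuarteU w * (t : ℂ) ^ (-w)‖ ≤ C := by
  induction L with
  | zero =>
    refine ⟨4 * Real.pi, fun w h0 h1 => ⟨continuousOn_hardyPhi h1, fun t ht ht1 => ?_⟩⟩
    rw [pow_zero, one_mul]
    exact (norm_hardyPhi_sub_le h0 h1 ht).trans (mul_le_of_le_one_right (by positivity) ht1)
  | succ L ih =>
    obtain ⟨C, hC⟩ := ih
    refine ⟨C, fun w h0 h1 => ?_⟩
    obtain ⟨hc, hb⟩ := hC w h0 h1
    refine ⟨continuousOn_integral_Ioc_div (integrableOn_of_norm_sub_cpow_le h1 hc hb),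
      fun t ht ht1 => ?_⟩
    rw [pow_succ', mul_assoc (1 / (1 - w))]
    exact norm_integral_Ioc_div_sub_le h1 hc hb ht ht1

theorem integrableOn_hardyIterate (L : ℕ) {w : ℂ} (h0 : 0 < w.re) (h1 : w.re < 1) (t : ℝ) :
    IntegrableOn (hardyIterate L w) (Ioc 0 t) := by
  obtain ⟨C, hC⟩ := hardyIterate_near_zero L
  exact integrableOn_of_norm_sub_cpow_le h1 (hC w h0 h1).1 (hC w h0 h1).2 t

theorem continuousOn_baezDuarteU :
    ContinuousOn baezDuarteU {w : ℂ | 0 < w.re ∧ w.re < 1} := by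
  intro w hw
  have hw1 := one_sub_ne_zero_of_re_lt_one hw.2
  have h2 : ContinuousAt (fun w : ℂ => (2 : ℂ) ^ (1 - w)) w :=
    ContinuousAt.const_cpow (by fun_prop) (Or.inl two_ne_zero)
  have hπ : ContinuousAt (fun w : ℂ => (Real.pi : ℂ) ^ (-w)) w :=
    ContinuousAt.const_cpow (by fun_prop) (Or.inl (Complex.ofReal_ne_zero.2 Real.pi_pos.ne'))
  have hΓ : ContinuousAt Complex.Gamma w := by
    refine (Complex.differentiableAt_Gamma w fun m h => ?_).continuousAt
    have := hw.1
    rw [h, Complex.neg_re, Complex.natCast_re] at this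
    linarith [(Nat.cast_nonneg m : (0 : ℝ) ≤ m)]
  exact (((((continuousAt_id.div (by fun_prop) hw1).mul h2).mul hπ).mul
    (by fun_prop)).mul hΓ).continuousWithinAt

theorem norm_integral_Ioc_one_le {f : ℝ → ℂ} {C : ℝ} (hC : 0 ≤ C) (L : ℕ)
    (hf : ∀ t : ℝ, 1 ≤ t → ‖f t‖ ≤ C * (1 + Real.log t) ^ L / t) {t : ℝ} (ht : 1 ≤ t) :
    ‖∫ u in Ioc 1 t, f u‖ ≤ C * (1 + Real.log t) ^ (L + 1) := by
  have hlog := Real.log_nonneg ht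
  have hi : IntervalIntegrable (fun u : ℝ => u⁻¹) volume 1 t :=
    ContinuousOn.intervalIntegrable_of_Icc ht
      (continuousOn_inv₀.mono fun x hx => (one_pos.trans_le hx.1).ne')
  calc ‖∫ u in Ioc 1 t, f u‖ ≤ ∫ u in Ioc 1 t, C * (1 + Real.log t) ^ L * u⁻¹ := by
        refine norm_integral_le_of_norm_le (hi.1.const_mul _) ?_
        filter_upwards [ae_restrict_mem measurableSet_Ioc] with u hu
        have hu0 : 0 < u := one_pos.trans hu.1
        have hlu := Real.log_nonneg hu.1.le
        refine (hf u hu.1.le).trans ?_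
        rw [div_eq_mul_inv]
        gcongr
        exact hu.2
    _ = C * (1 + Real.log t) ^ L * Real.log t := by
        rw [MeasureTheory.integral_const_mul, ← integral_of_le ht,
          integral_inv_of_pos one_pos (one_pos.trans_le ht), div_one]
    _ ≤ C * (1 + Real.log t) ^ (L + 1) := by
        rw [pow_succ, ← mul_assoc]
        gcongr
        linarith

theorem hardyIterate_at_top (L : ℕ) {Ω : Set ℂ} (hΩ : IsCompact Ω)
    (hsub : Ω ⊆ {w : ℂ | 0 < w.re ∧ w.re < 1}) :
    ∃ C : ℝ, 0 ≤ C ∧ ∀ w ∈ Ω, ∀ t : ℝ, 1 ≤ t →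
      ‖hardyIterate L w t‖ ≤ C * (1 + Real.log t) ^ L / t := by
  induction L with
  | zero =>
    obtain ⟨K, hK⟩ := hΩ.exists_bound_of_continuousOn
      (f := fun w : ℂ => 1 + ‖w‖ / (1 - w.re)) (ContinuousOn.add (by fun_prop)
        (ContinuousOn.div (by fun_prop) (by fun_prop) fun w hw => (sub_pos.2 (hsub hw).2).ne'))
    refine ⟨max K 0, le_max_right _ _, fun w hw t ht => ?_⟩
    have ht0 := one_pos.trans_le ht
    refine (norm_hardyPhi_le (hsub hw).2 ht0).trans ?_
    rw [pow_zero, mul_one]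
    gcongr
    exact (le_abs_self _).trans ((hK w hw).trans (le_max_left _ _))
  | succ L ih =>
    obtain ⟨C, hC0, hC⟩ := ih
    obtain ⟨D, hD⟩ := hardyIterate_near_zero (L + 1)
    obtain ⟨K, hK⟩ := hΩ.exists_bound_of_continuousOn
      (f := fun w : ℂ => (1 / (1 - w)) ^ (L + 1) * baezDuarteU w)
      (ContinuousOn.mul (ContinuousOn.pow (ContinuousOn.div (by fun_prop) (by fun_prop)
        fun w hw => one_sub_ne_zero_of_re_lt_one (hsub hw).2) _)
        (continuousOn_baezDuarteU.mono hsub))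
    refine ⟨max (K + D) 0 + C, by positivity, fun w hw t ht => ?_⟩
    have hw' := hsub hw
    have ht0 := one_pos.trans_le ht
    have hone : ‖∫ u in Ioc (0 : ℝ) 1, hardyIterate L w u‖ ≤ K + D := by
      have h := (hD w hw'.1 hw'.2).2 1 one_pos le_rfl
      rw [Complex.ofReal_one, Complex.one_cpow, mul_one, hardyIterate] at h
      beta_reduce at h
      rw [Complex.ofReal_one, div_one] at h
      have h' := norm_add_le_of_le h (hK w hw)
      rw [sub_add_cancel] at h'
      linarith
    have hi := integrableOn_hardyIterate L hw'.1 hw'.2 t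
    have hsplit : ∫ u in Ioc (0 : ℝ) t, hardyIterate L w u =
        (∫ u in Ioc (0 : ℝ) 1, hardyIterate L w u) + ∫ u in Ioc 1 t, hardyIterate L w u := by
      rw [← Ioc_union_Ioc_eq_Ioc zero_le_one ht, setIntegral_union
        (Ioc_disjoint_Ioc_of_le le_rfl) measurableSet_Ioc
        (hi.mono_set (Ioc_subset_Ioc_right ht)) (hi.mono_set (Ioc_subset_Ioc_left zero_le_one))]
    rw [hardyIterate]
    beta_reduce
    rw [norm_div, Complex.norm_real, Real.norm_of_nonneg ht0.le, hsplit]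
    gcongr
    rw [add_mul]
    refine (norm_add_le _ _).trans (add_le_add ?_ (norm_integral_Ioc_one_le hC0 L (hC w hw) ht))
    refine (hone.trans (le_max_left _ 0)).trans (le_mul_of_one_le_right (le_max_right _ _) ?_)
    exact one_le_pow₀ (by linarith [Real.log_nonneg ht])

/-- The Hardy averaging operator `M : f ↦ (t ↦ (1/t)∫₀^t f)` can be applied arbitrarily
many times to `φ_{w,0}` for `0 < Re w < 1` (all successive averaging integrals converge
absolutely); the iterates `M^L(φ_{w,0})` are `O((1+log t)^L/t)` on `[1,∞)` uniformly on
compact subsets of the open strip, and satisfy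
`M^L(φ_{w,0})(t) = (1/(1-w))^L·U(w)·t^{-w} + O(1)` on `(0,1]` uniformly on the strip. -/
theorem hardy_iterates_of_phi_zero :
    ∃ φ : ℂ → ℝ → ℂ, ∃ g : ℕ → ℂ → ℝ → ℂ,
      (∀ w : ℂ, w.re < 1 → ∀ t : ℝ, 0 < t →
        Filter.Tendsto
          (fun δ : ℝ => ∫ v in δ..1,
            (v : ℂ) ^ (-w)
              * ((deriv (fun x : ℝ =>
                  x * Real.sin (2 * Real.pi * t / x) / (Real.pi * t)) v : ℝ) : ℂ))
          (nhdsWithin 0 (Set.Ioi 0)) (nhds (φ w t))) ∧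
      g 0 = φ ∧
      (∀ L : ℕ, ∀ w : ℂ, 0 < w.re → w.re < 1 → ∀ t : ℝ, 0 < t →
        MeasureTheory.IntegrableOn (g L w) (Set.Ioc 0 t) ∧
          g (L + 1) w t = (∫ u in Set.Ioc (0:ℝ) t, g L w u) / (t : ℂ)) ∧
      (∀ L : ℕ, ∀ Ω : Set ℂ, IsCompact Ω → Ω ⊆ {w : ℂ | 0 < w.re ∧ w.re < 1} →
        ∃ C : ℝ, ∀ w ∈ Ω, ∀ t : ℝ, 1 ≤ t →
          ‖g L w t‖ ≤ C * (1 + Real.log t) ^ L / t) ∧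
      (∀ L : ℕ, ∃ C' : ℝ, ∀ w : ℂ, 0 < w.re → w.re < 1 → ∀ t : ℝ, 0 < t → t ≤ 1 →
        ‖g L w t - (1 / (1 - w)) ^ L * baezDuarteU w * (t : ℂ) ^ (-w)‖ ≤ C') := by
  refine ⟨hardyPhi, hardyIterate, fun w h1 t ht => hardyPhi_isLimit h1 ht, rfl,
    fun L w h0 h1 t _ => ⟨integrableOn_hardyIterate L h0 h1 t, rfl⟩, fun L Ω hΩ hsub => ?_,
    fun L => ?_⟩
  · obtain ⟨C, -, hC⟩ := hardyIterate_at_top L hΩ hsub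
    exact ⟨C, hC⟩
  · obtain ⟨C, hC⟩ := hardyIterate_near_zero L
    exact ⟨C, fun w h0 h1 => (hC w h0 h1).2⟩
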